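/- Let 0<x<1 be real, s∈ℂ with Re(s)>0, r∈ℂ, r* := r−1, and let n, m ≥ 1 be integers. Let u₁,…,u_{n+m} be complex numbers such that [u_k−u_j]_s ≠ 0 and [u_k−u_j+r]_s ≠ 0 for all j ≠ k. Then ∑_{J ⊆ {1,…,n+m}, |J|=n} ∏_{j∈J} ∏_{k∉J} ( [u_k−u_j+1]_s [u_k−u_j+r*]_s ) / ( [u_k−u_j]_s [u_k−u_j+r]_s ) = ∑_{J ⊆ {1,…,n+m}, |J|=m} ∏_{j∈J} ∏_{k∉J} ( [u_k−u_j+1]_s [u_k−u_j+r*]_s ) / ( [u_k−u_j]_s [u_k−u_j+r]_s ). -/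

import Mathlib

open Complex

/-- `x^w := exp(w · log x)` for real `x` and complex `w`. -/
noncomputable def xpow (x : ℝ) (w : ℂ) : ℂ := Complex.exp (w * (Real.log x : ℂ))

/-- The infinite `q`-Pochhammer product `(z;q)_∞ = ∏_{j=0}^∞ (1 − q^j z)`. -/
noncomputable def qPoch (z q : ℂ) : ℂ := ∏' j : ℕ, (1 - q ^ j * z)

/-- `Θ_q(z) = (z;q)_∞ (q z⁻¹;q)_∞ (q;q)_∞`. -/
noncomputable def jacTheta0 (q z : ℂ) : ℂ := qPoch z q * qPoch (q * z⁻¹) q * qPoch q q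

/-- The Jacobi theta function `[u]_r = x^{u²/r − u} Θ_{x^{2r}}(x^{2u}) / ((x^{2r};x^{2r})_∞)³`. -/
noncomputable def jTheta (x : ℝ) (r u : ℂ) : ℂ :=
  xpow x (u ^ 2 / r - u) * jacTheta0 (xpow x (2 * r)) (xpow x (2 * u)) /
    (qPoch (xpow x (2 * r)) (xpow x (2 * r))) ^ 3

open Filter Topology

lemma multipliable_one_sub_pow_mul {q : ℂ} (hq : ‖q‖ < 1) (z : ℂ) :
    Multipliable fun j : ℕ => 1 - q ^ j * z := by
  have h := multipliable_one_add_of_summable (f := fun j : ℕ => -(q ^ j * z)) (by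
    simpa using (summable_geometric_of_lt_one (norm_nonneg _) hq).mul_right ‖z‖)
  simpa [sub_eq_add_neg] using h

lemma qPoch_eq_one_sub_mul {q : ℂ} (hq : ‖q‖ < 1) (z : ℂ) :
    qPoch z q = (1 - z) * qPoch (q * z) q := by
  have h := tprod_eq_zero_mul' (f := fun j : ℕ => 1 - q ^ j * z)
    (by simpa [pow_succ, mul_assoc] using multipliable_one_sub_pow_mul hq (q * z))
  simpa [qPoch, pow_succ, mul_assoc] using h

lemma exists_pow_mul_eq_one_of_qPoch_eq_zero {q z : ℂ} (hq : ‖q‖ < 1) (h : qPoch z q = 0) :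
    ∃ j : ℕ, q ^ j * z = 1 := by
  by_contra! hne
  refine tprod_one_add_ne_zero_of_summable (f := fun j : ℕ => -(q ^ j * z)) (fun j => ?_) ?_ ?_
  · rw [← sub_eq_add_neg, sub_ne_zero]
    exact (hne j).symm
  · simpa using (summable_geometric_of_lt_one (norm_nonneg _) hq).mul_right ‖z‖
  · simpa [qPoch, sub_eq_add_neg] using h

lemma qPoch_self_ne_zero {q : ℂ} (hq : ‖q‖ < 1) : qPoch q q ≠ 0 := by
  intro h
  obtain ⟨j, hj⟩ := exists_pow_mul_eq_one_of_qPoch_eq_zero hq h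
  rw [← pow_succ] at hj
  have := pow_lt_one₀ (norm_nonneg q) hq j.succ_ne_zero
  rw [← norm_pow, Nat.succ_eq_add_one, hj] at this
  simp at this

lemma differentiable_qPoch {q : ℂ} (hq : ‖q‖ < 1) : Differentiable ℂ fun z => qPoch z q := by
  intro z₀
  have h := Summable.hasProdLocallyUniformlyOn_nat_one_add
    (f := fun (j : ℕ) (z : ℂ) => -(q ^ j * z))
    (K := Metric.ball (0 : ℂ) (‖z₀‖ + 1)) (u := fun j => ‖q‖ ^ j * (‖z₀‖ + 1)) Metric.isOpen_ball
    ((summable_geometric_of_lt_one (norm_nonneg _) hq).mul_right _)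
    (.of_forall fun j z hz => by
      simp only [norm_neg, norm_mul, norm_pow]
      gcongr
      exact (mem_ball_zero_iff.mp hz).le) (fun _ => by fun_prop)
  have hd := h.differentiableOn (.of_forall fun _ => by
    simpa [Finset.prod_fn] using DifferentiableOn.finsetProd (fun _ _ => by fun_prop))
    Metric.isOpen_ball
  simpa [qPoch, sub_eq_add_neg] using hd.differentiableAt (Metric.isOpen_ball.mem_nhds (by simp))

lemma jacTheta0_eq_one_sub_mul {q : ℂ} (hq : ‖q‖ < 1) (z : ℂ) :
    jacTheta0 q z = (1 - z) * (qPoch (q * z) q * qPoch (q * z⁻¹) q * qPoch q q) := by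
  rw [jacTheta0, qPoch_eq_one_sub_mul hq z]
  ring

lemma jacTheta0_inv {q : ℂ} (hq : ‖q‖ < 1) {z : ℂ} (hz : z ≠ 0) :
    jacTheta0 q z⁻¹ = -z⁻¹ * jacTheta0 q z := by
  rw [jacTheta0_eq_one_sub_mul hq, jacTheta0_eq_one_sub_mul hq, inv_inv]
  field_simp
  ring

lemma jacTheta0_mul_left {q : ℂ} (hq : ‖q‖ < 1) (hq0 : q ≠ 0) {z : ℂ} (hz : z ≠ 0) :
    jacTheta0 q (q * z) = -z⁻¹ * jacTheta0 q z := by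
  rw [jacTheta0_eq_one_sub_mul hq z, jacTheta0, mul_inv, mul_inv_cancel_left₀ hq0,
    qPoch_eq_one_sub_mul hq z⁻¹]
  field_simp
  ring

lemma exists_zpow_of_jacTheta0_eq_zero {q z : ℂ} (hq : ‖q‖ < 1) (hz : z ≠ 0)
    (h : jacTheta0 q z = 0) : ∃ k : ℤ, z = q ^ k := by
  simp only [jacTheta0, mul_eq_zero, qPoch_self_ne_zero hq, or_false] at h
  obtain h | h := h
  · obtain ⟨j, hj⟩ := exists_pow_mul_eq_one_of_qPoch_eq_zero hq h
    exact ⟨-j, by rw [zpow_neg, zpow_natCast]; exact eq_inv_of_mul_eq_one_right hj⟩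
  · obtain ⟨j, hj⟩ := exists_pow_mul_eq_one_of_qPoch_eq_zero hq h
    refine ⟨(j + 1 : ℕ), ?_⟩
    rw [← mul_assoc, ← pow_succ] at hj
    rw [zpow_natCast]
    exact ((mul_inv_eq_one₀ hz).mp hj).symm

lemma xpow_add (x : ℝ) (v w : ℂ) : xpow x (v + w) = xpow x v * xpow x w := by
  simp [xpow, add_mul, Complex.exp_add]

lemma xpow_neg (x : ℝ) (w : ℂ) : xpow x (-w) = (xpow x w)⁻¹ := by
  simp [xpow, Complex.exp_neg]

lemma xpow_ne_zero (x : ℝ) (w : ℂ) : xpow x w ≠ 0 := Complex.exp_ne_zero _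

lemma xpow_intCast_mul (x : ℝ) (k : ℤ) (w : ℂ) : xpow x (k * w) = xpow x w ^ k := by
  rw [xpow, xpow, ← Complex.exp_int_mul, mul_assoc]

lemma differentiable_xpow (x : ℝ) : Differentiable ℂ (xpow x) := by
  unfold xpow
  fun_prop

lemma norm_xpow_lt_one {x : ℝ} (hx0 : 0 < x) (hx1 : x < 1) {w : ℂ} (hw : 0 < w.re) :
    ‖xpow x w‖ < 1 := by
  rw [xpow, Complex.norm_exp, Real.exp_lt_one_iff]
  simpa using mul_neg_of_pos_of_neg hw (Real.log_neg hx0 hx1)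

section jTheta

variable {x : ℝ} (hx0 : 0 < x) (hx1 : x < 1) {s : ℂ} (hs : 0 < s.re)
include hx0 hx1 hs

lemma norm_nome_lt_one : ‖xpow x (2 * s)‖ < 1 := norm_xpow_lt_one hx0 hx1 (by simpa using hs)

lemma differentiable_jTheta : Differentiable ℂ (jTheta x s) := by
  have hp := differentiable_qPoch (norm_nome_lt_one hx0 hx1 hs)
  have hX := differentiable_xpow x
  unfold jTheta jacTheta0
  simp only [← xpow_neg]
  fun_prop

lemma jTheta_neg (u : ℂ) : jTheta x s (-u) = -jTheta x s u := by
  have h : (-u) ^ 2 / s - -u = (u ^ 2 / s - u) + 2 * u := by ring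
  rw [jTheta, jTheta, h, xpow_add, mul_neg, xpow_neg,
    jacTheta0_inv (norm_nome_lt_one hx0 hx1 hs) (xpow_ne_zero _ _)]
  field_simp [xpow_ne_zero]

lemma jTheta_add_period_left (u : ℂ) : jTheta x s (u + s) = -jTheta x s u := by
  have hs0 : s ≠ 0 := by rintro rfl; simp at hs
  have h : (u + s) ^ 2 / s - (u + s) = (u ^ 2 / s - u) + 2 * u := by field_simp; ring
  rw [jTheta, jTheta, h, xpow_add, mul_add, add_comm (2 * u) (2 * s), xpow_add x (2 * s),
    jacTheta0_mul_left (norm_nome_lt_one hx0 hx1 hs) (xpow_ne_zero _ _) (xpow_ne_zero _ _)]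
  field_simp [xpow_ne_zero]

omit hs in
lemma xpow_two_mul_eq_one_iff (u : ℂ) :
    xpow x (2 * u) = 1 ↔ ∃ n : ℤ, u = n * (Real.pi * I / Real.log x) := by
  have hl : (Real.log x : ℂ) ≠ 0 := mod_cast (Real.log_neg hx0 hx1).ne
  rw [xpow, Complex.exp_eq_one_iff]
  refine exists_congr fun n => ?_
  rw [← mul_div_assoc, eq_div_iff hl]
  constructor <;> intro h
  · linear_combination h / 2
  · linear_combination 2 * h

omit hs in
lemma jTheta_add_period_right (u : ℂ) :
    jTheta x s (u + Real.pi * I / Real.log x) =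
      -xpow x ((2 * u * (Real.pi * I / Real.log x) + (Real.pi * I / Real.log x) ^ 2) / s) *
        jTheta x s u := by
  have hl : (Real.log x : ℂ) ≠ 0 := mod_cast (Real.log_neg hx0 hx1).ne
  have h1 : xpow x (2 * (Real.pi * I / Real.log x)) = 1 :=
    (xpow_two_mul_eq_one_iff hx0 hx1 _).mpr ⟨1, by simp⟩
  have h2 : xpow x (-(Real.pi * I / Real.log x)) = -1 := by
    rw [xpow_neg, xpow, div_mul_cancel₀ _ hl, Complex.exp_pi_mul_I]
    norm_num
  set P : ℂ := Real.pi * I / Real.log x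
  have h : (u + P) ^ 2 / s - (u + P) = ((2 * u * P + P ^ 2) / s + (u ^ 2 / s - u)) + -P := by ring
  rw [jTheta, jTheta, h, xpow_add, xpow_add, mul_add 2 u P, xpow_add x (2 * u), h1, h2]
  ring_nf

lemma exists_of_jTheta_eq_zero {u : ℂ} (h : jTheta x s u = 0) :
    ∃ m n : ℤ, m * s + n * (Real.pi * I / Real.log x) = u := by
  have hq := norm_nome_lt_one hx0 hx1 hs
  simp only [jTheta, div_eq_zero_iff, mul_eq_zero, xpow_ne_zero, false_or, pow_eq_zero_iff,
    qPoch_self_ne_zero hq, or_false, ne_eq, OfNat.ofNat_ne_zero, not_false_eq_true] at h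
  obtain ⟨k, hk⟩ := exists_zpow_of_jacTheta0_eq_zero hq (xpow_ne_zero _ _) h
  have h1 : xpow x (2 * (u - k * s)) = 1 := by
    have : 2 * (u - k * s) = 2 * u + -(k * (2 * s)) := by ring
    rw [this, xpow_add, hk, xpow_neg, xpow_intCast_mul, mul_inv_cancel₀]
    exact zpow_ne_zero _ (xpow_ne_zero _ _)
  obtain ⟨n, hn⟩ := (xpow_two_mul_eq_one_iff hx0 hx1 _).mp h1
  exact ⟨k, n, by rw [← hn]; ring⟩

lemma deriv_jTheta_zero_ne_zero : deriv (jTheta x s) 0 ≠ 0 := by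
  have hq := norm_nome_lt_one hx0 hx1 hs
  have hl : (Real.log x : ℂ) ≠ 0 := mod_cast (Real.log_neg hx0 hx1).ne
  set q := xpow x (2 * s) with hqdef
  let g : ℂ → ℂ := fun u => xpow x (u ^ 2 / s - u) * (qPoch (q * xpow x (2 * u)) q *
    qPoch (q * xpow x (-(2 * u))) q * qPoch q q) / qPoch q q ^ 3
  have hg : Differentiable ℂ g := by
    have hp := differentiable_qPoch hq
    have hX := differentiable_xpow x
    fun_prop
  have hX0 : xpow x 0 = 1 := by simp [xpow]
  have hg0 : g 0 ≠ 0 := by simp [g, hX0, qPoch_self_ne_zero hq]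
  have he : jTheta x s = fun u => (1 - xpow x (2 * u)) * g u := by
    ext u
    simp only [jTheta, g, xpow_neg, ← hqdef, jacTheta0_eq_one_sub_mul hq]
    ring
  have hd : HasDerivAt (fun u => 1 - xpow x (2 * u)) (-(2 * Real.log x)) 0 := by
    have : HasDerivAt (fun u : ℂ => 2 * u * (Real.log x : ℂ)) (2 * Real.log x) 0 := by
      simpa using ((hasDerivAt_id (0 : ℂ)).const_mul 2).mul_const (Real.log x : ℂ)
    simpa [xpow] using this.cexp.const_sub 1
  rw [he, (hd.fun_mul (hg 0).hasDerivAt).deriv]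
  simpa [hX0, hg0] using hl

end jTheta

lemma PeriodPair.eventually_notMem_lattice (L : PeriodPair) (a : ℂ) {b : ℂ} (hb : b ≠ 0)
    (t₀ : ℂ) : ∀ᶠ t in 𝓝[≠] t₀, a + t * b ∉ L.lattice := by
  have h := L.compl_lattice_sdiff_singleton_mem_nhds (a + t₀ * b)
  have hc : ContinuousAt (fun t : ℂ => a + t * b) t₀ := by fun_prop
  filter_upwards [nhdsWithin_le_nhds (hc h), self_mem_nhdsWithin] with t ht hne hmem
  refine ht ⟨hmem, fun h => hne ?_⟩
  simpa [hb] using h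

lemma eventually_differentiableAt_nhds {φ : ℂ → ℂ} {a : ℂ}
    (hd : ∀ᶠ z in 𝓝[≠] a, DifferentiableAt ℂ φ z) :
    ∀ᶠ z in 𝓝[≠] a, ∀ᶠ w in 𝓝 z, DifferentiableAt ℂ φ w := by
  filter_upwards [eventually_eventually_nhdsWithin.mpr hd, self_mem_nhdsWithin] with z hz hne
  rwa [isOpen_compl_singleton.nhdsWithin_eq hne] at hz

/-- A doubly periodic function all of whose singularities are removable is constant. -/
lemma PeriodPair.exists_eq_of_removable (L : PeriodPair) {φ : ℂ → ℂ}
    (hper : ∀ z, ∀ w ∈ L.lattice, φ (z + w) = φ z)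
    (hd : ∀ a, ∀ᶠ z in 𝓝[≠] a, DifferentiableAt ℂ φ z)
    (hlim : ∀ a, Tendsto (fun z => (z - a) * φ z) (𝓝[≠] a) (𝓝 0)) :
    ∃ C, ∀ z, ContinuousAt φ z → φ z = C := by
  let H : ℂ → ℂ := fun a => limUnder (𝓝[≠] a) φ
  have hH : ∀ a, Tendsto φ (𝓝[≠] a) (𝓝 (H a)) := fun a => by
    refine Complex.tendsto_limUnder_of_differentiable_on_punctured_nhds_of_isLittleO (hd a) ?_
    rw [Asymptotics.isLittleO_iff_tendsto']
    · have h1 : Tendsto (fun z => (z - a) * φ a) (𝓝[≠] a) (𝓝 0) := by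
        have : ContinuousAt (fun z => (z - a) * φ a) a := by fun_prop
        simpa [ContinuousAt] using this.tendsto.mono_left nhdsWithin_le_nhds
      have h2 := (hlim a).sub h1
      simp only [sub_zero] at h2
      refine h2.congr fun z => ?_
      rw [div_inv_eq_mul]
      ring
    · filter_upwards [self_mem_nhdsWithin] with z hz h
      exact absurd (inv_eq_zero.mp h) (sub_ne_zero.mpr hz)
  have hcont : ∀ z, ContinuousAt φ z → H z = φ z := fun z hz =>
    (hz.tendsto.mono_left nhdsWithin_le_nhds).limUnder_eq
  have hdiff : Differentiable ℂ H := fun a => by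
    have hev := eventually_differentiableAt_nhds (hd a)
    refine (Complex.analyticAt_of_differentiable_on_punctured_nhds_of_continuousAt
      (c := a) ?_ ?_).differentiableAt
    · filter_upwards [hev] with z hz
      refine hz.self_of_nhds.congr_of_eventuallyEq ?_
      filter_upwards [hz] with w hw using hcont w hw.continuousAt
    · rw [← continuousWithinAt_compl_self]
      refine (hH a).congr' ?_
      filter_upwards [hd a] with z hz using (hcont z hz.continuousAt).symm
  have hHper : ∀ z, ∀ w ∈ L.lattice, H (z + w) = H z := fun z w hw => by
    refine Tendsto.limUnder_eq ?_
    have h1 : Tendsto (fun y => y - w) (𝓝[≠] (z + w)) (𝓝[≠] z) := by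
      refine tendsto_nhdsWithin_iff.mpr ⟨?_, ?_⟩
      · have : ContinuousAt (fun y : ℂ => y - w) (z + w) := by fun_prop
        simpa [ContinuousAt] using this.tendsto.mono_left nhdsWithin_le_nhds
      · filter_upwards [self_mem_nhdsWithin] with y hy h
        exact hy (by simpa [sub_eq_iff_eq_add] using h)
    refine ((hH z).comp h1).congr fun y => ?_
    simpa using (hper (y - w) w hw).symm
  refine ⟨H 0, fun z hz => ?_⟩
  rw [← hcont z hz]
  exact hdiff.apply_eq_apply_of_bounded (IsZLattice.isCompact_range_of_periodic L.lattice _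
    hdiff.continuous hHper).isBounded z 0

section SubsetSum

open Finset Function

variable {ι : Type*} [DecidableEq ι]

/-- The product of `f (u k - u j)` over `j ∈ J` and `k ∈ S \ J`. -/
def cutProd (f : ℂ → ℂ) (S J : Finset ι) (u : ι → ℂ) : ℂ :=
  ∏ j ∈ J, ∏ k ∈ S \ J, f (u k - u j)

/-- The sum of `cutProd f S J u` over `J ⊆ S`, weighted by a function of the size of `J`. -/
def cutSum (f : ℂ → ℂ) (c : ℕ → ℂ) (S : Finset ι) (u : ι → ℂ) : ℂ :=
  ∑ J ∈ S.powerset, c #J * cutProd f S J u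

lemma cutProd_congr {f g : ℂ → ℂ} {S J : Finset ι} {u w : ι → ℂ} (hJ : J ⊆ S)
    (h : ∀ j ∈ S, ∀ k ∈ S, f (u k - u j) = g (w k - w j)) :
    cutProd f S J u = cutProd g S J w :=
  prod_congr rfl fun j hj => prod_congr rfl fun k hk => h j (hJ hj) k (mem_sdiff.mp hk).1

lemma cutSum_congr {f g : ℂ → ℂ} {c : ℕ → ℂ} {S : Finset ι} {u w : ι → ℂ}
    (h : ∀ j ∈ S, ∀ k ∈ S, f (u k - u j) = g (w k - w j)) :
    cutSum f c S u = cutSum g c S w :=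
  sum_congr rfl fun _ hJ => by rw [cutProd_congr (mem_powerset.mp hJ) h]

lemma cutProd_insert_left {f : ℂ → ℂ} {S J : Finset ι} {u : ι → ℂ} {i : ι} (hi : i ∉ S)
    (hJ : J ⊆ S) :
    cutProd f (insert i S) J u = cutProd f S J u * ∏ j ∈ J, f (u i - u j) := by
  rw [cutProd, insert_sdiff_of_notMem _ (fun h => hi (hJ h)), cutProd, ← prod_mul_distrib]
  refine prod_congr rfl fun j _ => ?_
  rw [prod_insert (fun h => hi (mem_sdiff.mp h).1), mul_comm]

lemma cutProd_insert_insert {f : ℂ → ℂ} {S J : Finset ι} {u : ι → ℂ} {i : ι} (hi : i ∉ S)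
    (hJ : J ⊆ S) :
    cutProd f (insert i S) (insert i J) u = cutProd f S J u * ∏ k ∈ S \ J, f (u k - u i) := by
  have h : insert i S \ insert i J = S \ J := by
    rw [insert_sdiff_insert, sdiff_insert_of_notMem hi]
  rw [cutProd, h, prod_insert (fun h => hi (hJ h)), mul_comm, cutProd]

lemma cutSum_insert_update (f : ℂ → ℂ) (c : ℕ → ℂ) {T : Finset ι} (u : ι → ℂ) {i : ι}
    (hi : i ∉ T) (z : ℂ) :
    cutSum f c (insert i T) (update u i z) =
      ∑ K ∈ T.powerset, cutProd f T K u *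
        (c #K * ∏ j ∈ K, f (z - u j) + c (#K + 1) * ∏ k ∈ T \ K, f (u k - z)) := by
  have hu : ∀ k ∈ T, update u i z k = u k := fun k hk =>
    update_of_ne (ne_of_mem_of_not_mem hk hi) _ _
  rw [cutSum, sum_powerset_insert hi, ← sum_add_distrib]
  refine sum_congr rfl fun K hK => ?_
  rw [mem_powerset] at hK
  rw [cutProd_insert_left hi hK, cutProd_insert_insert hi hK,
    card_insert_of_notMem (fun h => hi (hK h)), update_self,
    cutProd_congr (g := f) (w := u) hK (fun j hj k hk => by rw [hu j hj, hu k hk]),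
    prod_congr rfl (fun j hj => by rw [hu j (hK hj)] :
      ∀ j ∈ K, f (z - update u i z j) = f (z - u j)),
    prod_congr rfl (fun k hk => by rw [hu k (mem_sdiff.mp hk).1] :
      ∀ k ∈ T \ K, f (update u i z k - z) = f (u k - z))]
  ring

lemma cutSum_insert_insert_update (f : ℂ → ℂ) (c : ℕ → ℂ) {T : Finset ι} (u : ι → ℂ) {i l : ι}
    (hil : i ≠ l) (hi : i ∉ T) (hl : l ∉ T) (z : ℂ) :
    cutSum f c (insert i (insert l T)) (update u i z) =
      ∑ K ∈ T.powerset, cutProd f T K u *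
        (c #K * ((∏ j ∈ K, f (u l - u j)) * ∏ j ∈ K, f (z - u j)) +
          c (#K + 1) * (f (u l - z) * (∏ k ∈ T \ K, f (u k - z)) * ∏ j ∈ K, f (u l - u j)) +
          c (#K + 1) * (f (z - u l) * (∏ k ∈ T \ K, f (u k - u l)) * ∏ j ∈ K, f (z - u j)) +
          c (#K + 2) * ((∏ k ∈ T \ K, f (u k - u l)) * ∏ k ∈ T \ K, f (u k - z))) := by
  have hil' : i ∉ insert l T := by simp [hil, hi]
  rw [cutSum_insert_update f c u hil', sum_powerset_insert hl, ← sum_add_distrib]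
  refine sum_congr rfl fun K hK => ?_
  rw [mem_powerset] at hK
  have hlK : l ∉ K := fun h => hl (hK h)
  have h : insert l T \ insert l K = T \ K := by
    rw [insert_sdiff_insert, sdiff_insert_of_notMem hl]
  rw [cutProd_insert_left hl hK, cutProd_insert_insert hl hK, card_insert_of_notMem hlK, h,
    prod_insert hlK, insert_sdiff_of_notMem _ hlK, prod_insert (fun h => hl (mem_sdiff.mp h).1)]
  ring

lemma tendsto_sub_mul_cutSum {f : ℂ → ℂ} (c : ℕ → ℂ) {T : Finset ι} {u : ι → ℂ} {i l : ι}
    (hil : i ≠ l) (hi : i ∉ T) (hl : l ∉ T) {a α β : ℂ}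
    (h1 : ∀ k ∈ T, ContinuousAt f (u k - a)) (h2 : ∀ k ∈ T, ContinuousAt f (a - u k))
    (hα : Tendsto (fun z => (z - a) * f (u l - z)) (𝓝[≠] a) (𝓝 α))
    (hβ : Tendsto (fun z => (z - a) * f (z - u l)) (𝓝[≠] a) (𝓝 β)) :
    Tendsto (fun z => (z - a) * cutSum f c (insert i (insert l T)) (update u i z)) (𝓝[≠] a)
      (𝓝 (∑ K ∈ T.powerset, cutProd f T K u * (c (#K + 1) *
        (α * (∏ k ∈ T \ K, f (u k - a)) * (∏ j ∈ K, f (u l - u j)) +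
          β * (∏ k ∈ T \ K, f (u k - u l)) * ∏ j ∈ K, f (a - u j))))) := by
  simp only [cutSum_insert_insert_update f c u hil hi hl, mul_sum]
  refine tendsto_finsetSum _ fun K hK => ?_
  rw [mem_powerset] at hK
  have h0 : Tendsto (fun z => z - a) (𝓝[≠] a) (𝓝 0) := by
    have : ContinuousAt (fun z : ℂ => z - a) a := by fun_prop
    simpa [ContinuousAt] using this.tendsto.mono_left nhdsWithin_le_nhds
  have hA : Tendsto (fun z => ∏ k ∈ T \ K, f (u k - z)) (𝓝[≠] a)
      (𝓝 (∏ k ∈ T \ K, f (u k - a))) := tendsto_finsetProd _ fun k hk =>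
    (ContinuousAt.comp' (f := fun z => u k - z) (h1 k (mem_sdiff.mp hk).1)
      (by fun_prop)).tendsto.mono_left nhdsWithin_le_nhds
  have hB : Tendsto (fun z => ∏ j ∈ K, f (z - u j)) (𝓝[≠] a)
      (𝓝 (∏ j ∈ K, f (a - u j))) := tendsto_finsetProd _ fun k hk =>
    (ContinuousAt.comp' (f := fun z => z - u k) (h2 k (hK hk))
      (by fun_prop)).tendsto.mono_left nhdsWithin_le_nhds
  have h := ((h0.mul hB).const_mul (c #K * ∏ j ∈ K, f (u l - u j))).add
    ((((hα.mul hA).const_mul (c (#K + 1) * ∏ j ∈ K, f (u l - u j))).add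
    ((hβ.mul hB).const_mul (c (#K + 1) * ∏ k ∈ T \ K, f (u k - u l)))).add
    ((h0.mul hA).const_mul (c (#K + 2) * ∏ k ∈ T \ K, f (u k - u l))))
  have h' := h.const_mul (cutProd f T K u)
  convert h' using 2 <;> ring

end SubsetSum

/-- `f` is elliptic for the lattice of `L`, is invariant under `v ↦ -v - r`, and is holomorphic
except for at most simple poles on the lattice and its translate by `-r`. -/
structure IsExchangeKernel (L : PeriodPair) (r : ℂ) (f : ℂ → ℂ) : Prop where
  periodic : ∀ v, ∀ w ∈ L.lattice, f (v + w) = f v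
  reflect : ∀ v, f (-v - r) = f v
  differentiableAt : ∀ v, v ∉ L.lattice → v + r ∉ L.lattice → DifferentiableAt ℂ f v
  residue : ∃ κ, Tendsto (fun v => v * f v) (𝓝[≠] 0) (𝓝 κ)

/-- `d` avoids the lattice even after adding at most two copies of `r` or `-r`. -/
def IsGeneric (L : PeriodPair) (r d : ℂ) : Prop :=
  ∀ c ∈ Finset.Icc (-2 : ℤ) 2, d + c * r ∉ L.lattice

lemma tendsto_neg_nhdsNE_zero : Tendsto (fun v : ℂ => -v) (𝓝[≠] 0) (𝓝[≠] 0) := by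
  refine tendsto_nhdsWithin_iff.mpr ⟨?_, ?_⟩
  · have : ContinuousAt (fun y : ℂ => -y) 0 := by fun_prop
    simpa [ContinuousAt] using this.tendsto.mono_left nhdsWithin_le_nhds
  · filter_upwards [self_mem_nhdsWithin] with y hy
    simpa using hy

lemma tendsto_sub_nhdsNE (a : ℂ) : Tendsto (fun z : ℂ => z - a) (𝓝[≠] a) (𝓝[≠] 0) := by
  refine tendsto_nhdsWithin_iff.mpr ⟨?_, ?_⟩
  · have : ContinuousAt (fun y : ℂ => y - a) a := by fun_prop
    simpa [ContinuousAt] using this.tendsto.mono_left nhdsWithin_le_nhds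
  · filter_upwards [self_mem_nhdsWithin] with y hy
    simpa [sub_eq_zero] using hy

lemma tendsto_sub_mul_of_continuousAt {φ : ℂ → ℂ} {a : ℂ} (h : ContinuousAt φ a) :
    Tendsto (fun z => (z - a) * φ z) (𝓝[≠] a) (𝓝 0) := by
  have h' : ContinuousAt (fun z => (z - a) * φ z) a := by fun_prop
  simpa [ContinuousAt] using h'.tendsto.mono_left nhdsWithin_le_nhds

namespace IsGeneric

variable {L : PeriodPair} {r d : ℂ}

lemma neg (h : IsGeneric L r d) : IsGeneric L r (-d) := fun c hc hm => by
  refine h (-c) (by simp only [Finset.mem_Icc] at hc ⊢; omega) ?_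
  have := neg_mem hm
  convert this using 1
  push_cast
  ring

lemma neg_shift (h : IsGeneric L r d) : IsGeneric L (-r) d := fun c hc hm => by
  refine h (-c) (by simp only [Finset.mem_Icc] at hc ⊢; omega) ?_
  convert hm using 1
  push_cast
  ring

lemma notMem (h : IsGeneric L r d) : d ∉ L.lattice := by simpa using h 0 (by simp)

lemma add_notMem (h : IsGeneric L r d) : d + r ∉ L.lattice := by simpa using h 1 (by simp)

lemma sub_notMem (h : IsGeneric L r d) : d - r ∉ L.lattice := by
  simpa [sub_eq_add_neg] using h (-1) (by simp)

lemma add_add_notMem (h : IsGeneric L r d) : d + r + r ∉ L.lattice := by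
  simpa [two_mul, add_assoc] using h 2 (by simp)

end IsGeneric

namespace IsExchangeKernel

open Finset Function

variable {L : PeriodPair} {r : ℂ} {f : ℂ → ℂ}

lemma neg (hf : IsExchangeKernel L r f) : IsExchangeKernel L (-r) fun v => f (-v) where
  periodic v w hw := by
    rw [neg_add]
    exact hf.periodic _ _ (neg_mem hw)
  reflect v := by
    rw [← hf.reflect (-v)]
    ring_nf
  differentiableAt v h1 h2 := by
    refine DifferentiableAt.fun_comp' (f := fun v : ℂ => -v) v (hf.differentiableAt (-v) ?_ ?_)
      (by fun_prop)
    · exact fun h => h1 (by simpa using neg_mem h)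
    · exact fun h => h2 (by simpa [neg_add, add_comm] using neg_mem h)
  residue := by
    obtain ⟨κ, hκ⟩ := hf.residue
    refine ⟨-κ, ((hκ.comp tendsto_neg_nhdsNE_zero).neg).congr fun v => ?_⟩
    simp

variable {ι : Type*} [DecidableEq ι] {c : ℕ → ℂ} {T : Finset ι} {u : ι → ℂ} {i l : ι}

lemma tendsto_cutSum_diagonal (hf : IsExchangeKernel L r f) (c : ℕ → ℂ)
    (hil : i ≠ l) (hi : i ∉ T) (hl : l ∉ T) (hu : ∀ k ∈ T, IsGeneric L r (u k - u l)) :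
    Tendsto (fun z => (z - u l) * cutSum f c (insert i (insert l T)) (update u i z))
      (𝓝[≠] u l) (𝓝 0) := by
  obtain ⟨κ, hκ⟩ := hf.residue
  have h := tendsto_sub_mul_cutSum (f := f) c (u := u) (a := u l) (α := -κ) (β := κ) hil hi hl
    (fun k hk => (hf.differentiableAt _ (hu k hk).notMem (hu k hk).add_notMem).continuousAt)
    (fun k hk => by
      have h := (hu k hk).neg
      rw [neg_sub] at h
      exact (hf.differentiableAt _ h.notMem h.add_notMem).continuousAt) ?_ ?_
  · convert h using 2
    refine (sum_eq_zero fun K _ => ?_).symm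
    ring
  · refine ((hκ.comp (tendsto_neg_nhdsNE_zero.comp (tendsto_sub_nhdsNE (u l)))).neg).congr
      fun z => ?_
    simp only [comp_apply, neg_sub]
    ring
  · exact hκ.comp (tendsto_sub_nhdsNE (u l))

lemma tendsto_cutSum_sub_shift (hf : IsExchangeKernel L r f) (hr : r ∉ L.lattice)
    (hr2 : r + r ∉ L.lattice)
    (hil : i ≠ l) (hi : i ∉ T) (hl : l ∉ T) (hu : ∀ k ∈ T, IsGeneric L r (u k - u l))
    (ih : cutSum f (fun n => c (n + 1)) T u = cutSum (fun v => f (-v)) (fun n => c (n + 1)) T u) :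
    Tendsto (fun z => (z - (u l + r)) * (cutSum f c (insert i (insert l T)) (update u i z) -
        cutSum (fun v => f (-v)) c (insert i (insert l T)) (update u i z)))
      (𝓝[≠] (u l + r)) (𝓝 0) := by
  obtain ⟨κ, hκ⟩ := hf.residue
  have hpole : Tendsto (fun z => (z - (u l + r)) * f (u l - z)) (𝓝[≠] (u l + r)) (𝓝 κ) := by
    refine (hκ.comp (tendsto_sub_nhdsNE (u l + r))).congr fun z => ?_
    rw [comp_apply, ← hf.reflect (z - (u l + r))]
    ring_nf
  have hreg : Tendsto (fun z => (z - (u l + r)) * f (z - u l)) (𝓝[≠] (u l + r)) (𝓝 0) := by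
    refine tendsto_sub_mul_of_continuousAt (φ := fun z => f (z - u l)) ?_
    refine ContinuousAt.comp' (f := fun z => z - u l) ?_ (by fun_prop)
    rw [add_sub_cancel_left]
    exact (hf.differentiableAt r hr hr2).continuousAt
  have hc1 : ∀ k ∈ T, ContinuousAt f (u k - (u l + r)) := fun k hk => by
    have h := hu k hk
    refine (hf.differentiableAt _ ?_ ?_).continuousAt
    · simpa [sub_sub] using h.sub_notMem
    · convert h.notMem using 2
      ring
  have hc2 : ∀ k ∈ T, ContinuousAt f (u l + r - u k) := fun k hk => by
    have h := (hu k hk).neg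
    rw [neg_sub] at h
    refine (hf.differentiableAt _ ?_ ?_).continuousAt
    · convert h.add_notMem using 2
      ring
    · convert h.add_add_notMem using 2
      ring
  have hn : ∀ v, ContinuousAt f (-v) → ContinuousAt (fun v => f (-v)) v := fun v hv =>
    ContinuousAt.comp' (f := fun v : ℂ => -v) hv (by fun_prop)
  have hrefl : ∀ k, f (u k - (u l + r)) = f (u l - u k) := fun k => by
    rw [← hf.reflect (u l - u k)]
    ring_nf
  have hprod : ∀ K ∈ T.powerset,
      (∏ k ∈ T \ K, f (u l - u k)) * ∏ k ∈ K, f (u l - u k) = ∏ k ∈ T, f (u l - u k) :=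
    fun K hK => prod_sdiff (mem_powerset.mp hK)
  have t1 := tendsto_sub_mul_cutSum c hil hi hl hc1 hc2 hpole hreg
  have t2 := tendsto_sub_mul_cutSum (f := fun v => f (-v)) (α := 0) (β := κ) (a := u l + r)
    (u := u) c hil hi hl
    (fun k hk => hn _ (by rw [neg_sub]; exact hc2 k hk))
    (fun k hk => hn _ (by rw [neg_sub]; exact hc1 k hk))
    (by simpa only [neg_sub] using hreg) (by simpa only [neg_sub] using hpole)
  have t := t1.sub t2
  simp only [← mul_sub] at t
  convert t using 2
  symm
  rw [sub_eq_zero]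
  trans κ * (∏ k ∈ T, f (u l - u k)) * cutSum f (fun n => c (n + 1)) T u
  · rw [cutSum, mul_sum]
    refine sum_congr rfl fun K hK => ?_
    rw [← hprod K hK]
    simp only [hrefl]
    ring
  · rw [ih, cutSum, mul_sum]
    refine sum_congr rfl fun K hK => ?_
    rw [← hprod K hK]
    simp only [neg_sub, hrefl]
    ring

lemma differentiableAt_cutSum_update (hf : IsExchangeKernel L r f) (c : ℕ → ℂ) (hi : i ∉ T) {z : ℂ}
    (hz : ∀ k ∈ T, z - u k ∉ L.lattice ∧ z - u k + r ∉ L.lattice ∧ z - u k - r ∉ L.lattice) :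
    DifferentiableAt ℂ (fun z => cutSum f c (insert i T) (update u i z)) z := by
  simp only [cutSum_insert_update f c u hi]
  have h1 : ∀ k ∈ T, DifferentiableAt ℂ (fun z => f (z - u k)) z := fun k hk =>
    DifferentiableAt.fun_comp' (f := fun z => z - u k) z
      (hf.differentiableAt _ (hz k hk).1 (hz k hk).2.1) (by fun_prop)
  have h2 : ∀ k ∈ T, DifferentiableAt ℂ (fun z => f (u k - z)) z := fun k hk => by
    refine DifferentiableAt.fun_comp' (f := fun z => u k - z) z
      (hf.differentiableAt _ (fun h => (hz k hk).1 ?_) (fun h => (hz k hk).2.2 ?_)) (by fun_prop)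
    · simpa using neg_mem h
    · convert neg_mem h using 1
      ring
  refine DifferentiableAt.fun_sum fun K hK => ?_
  rw [mem_powerset] at hK
  have h3 : DifferentiableAt ℂ (fun z => ∏ j ∈ K, f (z - u j)) z :=
    DifferentiableAt.fun_finsetProd fun j hj => h1 j (hK hj)
  have h4 : DifferentiableAt ℂ (fun z => ∏ k ∈ T \ K, f (u k - z)) z :=
    DifferentiableAt.fun_finsetProd fun k hk => h2 k (mem_sdiff.mp hk).1
  fun_prop

lemma cutSum_update_add (hf : IsExchangeKernel L r f) (c : ℕ → ℂ) (hi : i ∉ T) (z : ℂ) {w : ℂ}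
    (hw : w ∈ L.lattice) :
    cutSum f c (insert i T) (update u i (z + w)) = cutSum f c (insert i T) (update u i z) := by
  simp only [cutSum_insert_update f c u hi]
  refine sum_congr rfl fun K _ => ?_
  congr 3
  · refine prod_congr rfl fun j _ => ?_
    rw [add_sub_right_comm, hf.periodic _ _ hw]
  · refine prod_congr rfl fun k _ => ?_
    rw [sub_add_eq_sub_sub, sub_eq_add_neg _ w, hf.periodic _ _ (neg_mem hw)]

lemma tendsto_cutSum_sub (hf : IsExchangeKernel L r f) (hr : r ∉ L.lattice)
    (hr2 : r + r ∉ L.lattice) (hi : i ∉ T)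
    (hu : ∀ j ∈ T, ∀ k ∈ T, j ≠ k → IsGeneric L r (u k - u j))
    (ih : ∀ l ∈ T, cutSum f (fun n => c (n + 1)) (T.erase l) u =
      cutSum (fun v => f (-v)) (fun n => c (n + 1)) (T.erase l) u) (a : ℂ) :
    Tendsto (fun z => (z - a) * (cutSum f c (insert i T) (update u i z) -
        cutSum (fun v => f (-v)) c (insert i T) (update u i z))) (𝓝[≠] a) (𝓝 0) := by
  set φ : ℂ → ℂ := fun z => cutSum f c (insert i T) (update u i z) -
        cutSum (fun v => f (-v)) c (insert i T) (update u i z) with hφ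
  have hnr : -r ∉ L.lattice := by simpa using hr
  have hnr2 : -r + -r ∉ L.lattice := by rwa [← neg_add, neg_mem_iff]
  have key : ∀ l ∈ T, ∀ b, (b = u l ∨ b = u l + r ∨ b = u l + -r) →
      Tendsto (fun z => (z - b) * φ z) (𝓝[≠] b) (𝓝 0) := by
    intro l hl b hb
    have hil : i ≠ l := (ne_of_mem_of_not_mem hl hi).symm
    have hie : i ∉ T.erase l := fun h => hi (mem_of_mem_erase h)
    have hue : ∀ k ∈ T.erase l, IsGeneric L r (u k - u l) := fun k hk =>
      hu l hl k (mem_of_mem_erase hk) (ne_of_mem_erase hk).symm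
    have hT : insert i T = insert i (insert l (T.erase l)) := by rw [insert_erase hl]
    rw [hφ, hT]
    rcases hb with rfl | rfl | rfl
    · have h1 := hf.tendsto_cutSum_diagonal c hil hie (notMem_erase l T) hue
      have h2 := hf.neg.tendsto_cutSum_diagonal c hil hie (notMem_erase l T)
        fun k hk => (hue k hk).neg_shift
      simpa only [← mul_sub, sub_zero] using h1.sub h2
    · exact hf.tendsto_cutSum_sub_shift hr hr2 hil hie (notMem_erase l T) hue (ih l hl)
    · have h := (hf.neg.tendsto_cutSum_sub_shift (c := c) hnr hnr2 hil hie (notMem_erase l T)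
        (fun k hk => (hue k hk).neg_shift) (by simpa only [neg_neg] using (ih l hl).symm)).neg
      simpa only [neg_neg, neg_zero, ← mul_neg, neg_sub] using h
  have hper : ∀ z, ∀ w ∈ L.lattice, φ (z + w) = φ z := fun z w hw => by
    simp only [hφ, hf.cutSum_update_add c hi z hw, hf.neg.cutSum_update_add c hi z hw]
  have shift : ∀ l ∈ T, ∀ b, (b = u l ∨ b = u l + r ∨ b = u l + -r) → a - b ∈ L.lattice →
      Tendsto (fun z => (z - a) * φ z) (𝓝[≠] a) (𝓝 0) := by
    intro l hl b hb hab
    have hmap : Tendsto (fun z => z - (a - b)) (𝓝[≠] a) (𝓝[≠] b) := by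
      refine tendsto_nhdsWithin_iff.mpr ⟨?_, ?_⟩
      · have : ContinuousAt (fun y : ℂ => y - (a - b)) a := by fun_prop
        simpa [ContinuousAt] using this.tendsto.mono_left nhdsWithin_le_nhds
      · filter_upwards [self_mem_nhdsWithin] with y hy h
        exact hy (by simpa [sub_eq_iff_eq_add] using h)
    refine ((key l hl b hb).comp hmap).congr fun z => ?_
    have := hper (z - (a - b)) (a - b) hab
    rw [sub_add_cancel] at this
    rw [comp_apply, ← this]
    ring
  by_cases hgood : ∀ k ∈ T, a - u k ∉ L.lattice ∧ a - u k + r ∉ L.lattice ∧ a - u k - r ∉ L.lattice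
  · refine tendsto_sub_mul_of_continuousAt (DifferentiableAt.continuousAt (𝕜 := ℂ) ?_)
    refine (hf.differentiableAt_cutSum_update c hi hgood).sub
      (hf.neg.differentiableAt_cutSum_update c hi fun k hk => ?_)
    obtain ⟨h1, h2, h3⟩ := hgood k hk
    exact ⟨h1, by rwa [← sub_eq_add_neg], by rwa [sub_neg_eq_add]⟩
  · push Not at hgood
    obtain ⟨l, hl, h⟩ := hgood
    by_cases h1 : a - u l ∈ L.lattice
    · exact shift l hl _ (.inl rfl) h1
    by_cases h2 : a - u l + r ∈ L.lattice
    · refine shift l hl _ (.inr (.inr rfl)) ?_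
      convert h2 using 1
      ring
    · refine shift l hl _ (.inr (.inl rfl)) ?_
      convert h h1 h2 using 1
      ring

lemma exists_cutSum_sub_eq (hf : IsExchangeKernel L r f) (hr : r ∉ L.lattice)
    (hr2 : r + r ∉ L.lattice) (hi : i ∉ T)
    (hu : ∀ j ∈ T, ∀ k ∈ T, j ≠ k → IsGeneric L r (u k - u j))
    (ih : ∀ l ∈ T, cutSum f (fun n => c (n + 1)) (T.erase l) u =
      cutSum (fun v => f (-v)) (fun n => c (n + 1)) (T.erase l) u) :
    ∃ C, ∀ z, (∀ k ∈ T, IsGeneric L r (z - u k)) →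
      cutSum f c (insert i T) (update u i z) -
        cutSum (fun v => f (-v)) c (insert i T) (update u i z) = C := by
  have hdiff : ∀ z, (∀ k ∈ T, z - u k ∉ L.lattice ∧ z - u k + r ∉ L.lattice ∧
      z - u k - r ∉ L.lattice) → DifferentiableAt ℂ (fun z =>
        cutSum f c (insert i T) (update u i z) -
          cutSum (fun v => f (-v)) c (insert i T) (update u i z)) z := fun z hz => by
    refine (hf.differentiableAt_cutSum_update c hi hz).sub
      (hf.neg.differentiableAt_cutSum_update c hi fun k hk => ?_)
    obtain ⟨h1, h2, h3⟩ := hz k hk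
    exact ⟨h1, by rwa [← sub_eq_add_neg], by rwa [sub_neg_eq_add]⟩
  obtain ⟨C, hC⟩ := L.exists_eq_of_removable (φ := fun z =>
      cutSum f c (insert i T) (update u i z) -
        cutSum (fun v => f (-v)) c (insert i T) (update u i z))
    (fun z w hw => by
      simp only [hf.cutSum_update_add c hi z hw, hf.neg.cutSum_update_add c hi z hw])
    (fun a => by
      have hev : ∀ᶠ z in 𝓝[≠] a, ∀ k ∈ T, z - u k ∉ L.lattice ∧ z - u k + r ∉ L.lattice ∧
          z - u k - r ∉ L.lattice := by
        refine (eventually_all_finset T).mpr fun k _ => ?_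
        filter_upwards [L.eventually_notMem_lattice (-u k) one_ne_zero a,
          L.eventually_notMem_lattice (-u k + r) one_ne_zero a,
          L.eventually_notMem_lattice (-u k - r) one_ne_zero a] with z h1 h2 h3
        refine ⟨?_, ?_, ?_⟩
        · convert h1 using 2; ring
        · convert h2 using 2; ring
        · convert h3 using 2; ring
      filter_upwards [hev] with z hz using hdiff z hz)
    (hf.tendsto_cutSum_sub hr hr2 hi hu ih)
  exact ⟨C, fun z hz => hC z (hdiff z fun k hk =>
    ⟨(hz k hk).notMem, (hz k hk).add_notMem, (hz k hk).sub_notMem⟩).continuousAt⟩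

lemma cutSum_sub_congr (hf : IsExchangeKernel L r f) (hr : r ∉ L.lattice)
    (hr2 : r + r ∉ L.lattice) {S : Finset ι} {w : ι → ℂ}
    (hu : ∀ j ∈ S, ∀ k ∈ S, j ≠ k → IsGeneric L r (u k - u j))
    (hw : ∀ j ∈ S, ∀ k ∈ S, j ≠ k → IsGeneric L r (w k - w j))
    (huw : ∀ j ∈ S, ∀ k ∈ S, j ≠ k → IsGeneric L r (w k - u j))
    (ih : ∀ T ⊂ S, ∀ c u, (∀ j ∈ T, ∀ k ∈ T, j ≠ k → IsGeneric L r (u k - u j)) →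
      cutSum f c T u = cutSum (fun v => f (-v)) c T u) :
    cutSum f c S u - cutSum (fun v => f (-v)) c S u =
      cutSum f c S w - cutSum (fun v => f (-v)) c S w := by
  have step : ∀ A ⊆ S, cutSum f c S (A.piecewise w u) -
      cutSum (fun v => f (-v)) c S (A.piecewise w u) =
        cutSum f c S u - cutSum (fun v => f (-v)) c S u := by
    intro A
    induction A using Finset.induction_on with
    | empty => simp
    | insert i A hiA hind =>
      intro hA
      have hiS : i ∈ S := hA (mem_insert_self i A)
      rw [← hind ((subset_insert i A).trans hA)]
      set y := A.piecewise w u with hy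
      have hyi : y i = u i := piecewise_eq_of_notMem _ _ _ hiA
      have hyk : ∀ k, y k = w k ∨ y k = u k := fun k => by
        by_cases hk : k ∈ A
        · exact .inl (piecewise_eq_of_mem _ _ _ hk)
        · exact .inr (piecewise_eq_of_notMem _ _ _ hk)
      have hgen : ∀ j ∈ S, ∀ k ∈ S, j ≠ k → IsGeneric L r (y k - y j) := by
        intro j hj k hk hjk
        rcases hyk j with h1 | h1 <;> rcases hyk k with h2 | h2 <;> rw [h1, h2]
        · exact hw j hj k hk hjk
        · simpa using (huw k hk j hj hjk.symm).neg
        · exact huw j hj k hk hjk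
        · exact hu j hj k hk hjk
      have hsub : ∀ l, (S.erase i).erase l ⊂ S := fun l =>
        (erase_subset _ _).trans_ssubset (erase_ssubset hiS)
      obtain ⟨C, hC⟩ := hf.exists_cutSum_sub_eq (c := c) hr hr2 (notMem_erase i S) (u := y)
        (fun j hj k hk => hgen j (mem_of_mem_erase hj) k (mem_of_mem_erase hk))
        (fun l _ => ih _ (hsub l) _ _ fun j hj k hk =>
          hgen j ((hsub l).1 hj) k ((hsub l).1 hk))
      rw [insert_erase hiS] at hC
      have h1 := hC (w i) fun k hk => by
        have hkS := mem_of_mem_erase hk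
        have hki := ne_of_mem_erase hk
        rcases hyk k with h | h <;> rw [h]
        · exact hw k hkS i hiS hki
        · exact huw k hkS i hiS hki
      have h2 := hC (y i) fun k hk =>
        hgen k (mem_of_mem_erase hk) i hiS (ne_of_mem_erase hk)
      rw [update_eq_self] at h2
      rw [piecewise_insert, ← hy, h1, h2]
  rw [← step S subset_rfl]
  have hS : ∀ k ∈ S, S.piecewise w u k = w k := fun k hk => piecewise_eq_of_mem _ _ _ hk
  congr 1 <;> exact cutSum_congr fun j hj k hk => by rw [hS j hj, hS k hk]

theorem cutSum_eq_cutSum_neg [Encodable ι] (hf : IsExchangeKernel L r f) (hr : r ∉ L.lattice)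
    (hr2 : r + r ∉ L.lattice) (S : Finset ι) (c : ℕ → ℂ) (u : ι → ℂ)
    (hu : ∀ j ∈ S, ∀ k ∈ S, j ≠ k → IsGeneric L r (u k - u j)) :
    cutSum f c S u = cutSum (fun v => f (-v)) c S u := by
  induction S using Finset.strongInduction generalizing c u with
  | H S ih =>
  let v : ι → ℂ := fun j => (Encodable.encode j : ℂ) + 1
  have hv0 : ∀ j, v j ≠ 0 := fun j => Nat.cast_add_one_ne_zero _
  have hv : ∀ j k, j ≠ k → v k - v j ≠ 0 := fun j k hjk h => hjk <| by
    simpa [v, sub_eq_zero, eq_comm] using h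
  have hev : ∀ a b : ℂ, b ≠ 0 → ∀ᶠ t in 𝓝[≠] (0 : ℂ), IsGeneric L r (a + t * b) := by
    intro a b hb
    refine (eventually_all_finset _).mpr fun n _ => ?_
    filter_upwards [L.eventually_notMem_lattice (a + n * r) hb 0] with t ht
    convert ht using 2
    ring
  have hall : ∀ᶠ t in 𝓝[≠] (0 : ℂ), ∀ j ∈ S, ∀ k ∈ S, j ≠ k →
      IsGeneric L r (t * v k - t * v j) ∧ IsGeneric L r (t * v k - u j) ∧
        IsGeneric L r (t * v k - -u j) := by
    refine (eventually_all_finset S).mpr fun j _ => (eventually_all_finset S).mpr fun k _ => ?_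
    by_cases hjk : j = k
    · exact .of_forall fun _ h => absurd hjk h
    filter_upwards [hev 0 _ (hv j k hjk), hev (-u j) _ (hv0 k), hev (u j) _ (hv0 k)]
      with t h1 h2 h3 _
    refine ⟨?_, ?_, ?_⟩
    · convert h1 using 1; ring
    · convert h2 using 1; ring
    · convert h3 using 1; ring
  obtain ⟨t, ht⟩ := hall.exists
  have e1 := hf.cutSum_sub_congr (c := c) hr hr2 (w := fun k => t * v k) hu
    (fun j hj k hk h => (ht j hj k hk h).1) (fun j hj k hk h => (ht j hj k hk h).2.1) ih
  have e2 := hf.cutSum_sub_congr (c := c) hr hr2 (u := fun k => -u k) (w := fun k => t * v k)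
    (fun j hj k hk h => by
      convert (hu j hj k hk h).neg using 1
      ring)
    (fun j hj k hk h => (ht j hj k hk h).1) (fun j hj k hk h => (ht j hj k hk h).2.2) ih
  have e3 : cutSum f c S (fun k => -u k) = cutSum (fun v => f (-v)) c S u :=
    cutSum_congr fun j _ k _ => by ring_nf
  have e4 : cutSum (fun v => f (-v)) c S (fun k => -u k) = cutSum f c S u :=
    cutSum_congr fun j _ k _ => by ring_nf
  rw [e3, e4] at e2
  linear_combination (e1 - e2) / 2

end IsExchangeKernel

section jTheta

variable {x : ℝ} (hx0 : 0 < x) (hx1 : x < 1) {s : ℂ} (hs : 0 < s.re)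

/-- The zeros of `jTheta x s` form the lattice spanned by `s` and `π i / log x`. -/
noncomputable def jThetaPeriodPair : PeriodPair where
  ω₁ := s
  ω₂ := Real.pi * I / Real.log x
  indep := by
    have hl : Real.log x ≠ 0 := (Real.log_neg hx0 hx1).ne
    rw [LinearIndependent.pair_iff]
    intro a b h
    have hP : Real.pi * I / Real.log x = ((Real.pi / Real.log x : ℝ) : ℂ) * I := by
      push_cast
      ring
    rw [hP] at h
    have hre := congrArg Complex.re h
    have him := congrArg Complex.im h
    simp only [real_smul, add_re, mul_re, ofReal_re, ofReal_im, I_re, I_im, zero_mul, mul_zero,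
      sub_zero, zero_re, mul_one, add_zero, sub_self, mul_im] at hre
    obtain rfl : a = 0 := (mul_eq_zero.mp hre).resolve_right hs.ne'
    simpa [Real.pi_ne_zero, hl, hx0.ne'] using him

lemma jTheta_add_eq_zero_iff (u : ℂ) {w : ℂ} (hw : w ∈ (jThetaPeriodPair hx0 hx1 hs).lattice) :
    jTheta x s (u + w) = 0 ↔ jTheta x s u = 0 := by
  induction hw using Submodule.span_induction generalizing u with
  | mem w hw =>
    obtain h | h := hw
    · have h : w = s := h
      rw [h, jTheta_add_period_left hx0 hx1 hs, neg_eq_zero]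
    · have h : w = Real.pi * I / Real.log x := h
      rw [h, jTheta_add_period_right hx0 hx1]
      simp [xpow_ne_zero]
  | zero => simp
  | add v w _ _ hv hw => rw [← add_assoc, hw, hv]
  | smul n w _ hw =>
    have h : ∀ (n : ℕ) u, jTheta x s (u + n * w) = 0 ↔ jTheta x s u = 0 := by
      intro n
      induction n with
      | zero => simp
      | succ n ih =>
        intro u
        rw [Nat.cast_succ, add_mul, one_mul, ← add_assoc, hw, ih]
    obtain ⟨n, rfl | rfl⟩ := n.eq_nat_or_neg
    · simpa using h n u
    · simpa using (h n (u + -(n * w))).symm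

lemma jTheta_eq_zero_iff (u : ℂ) :
    jTheta x s u = 0 ↔ u ∈ (jThetaPeriodPair hx0 hx1 hs).lattice := by
  refine ⟨fun h => PeriodPair.mem_lattice.mpr (exists_of_jTheta_eq_zero hx0 hx1 hs h), fun h => ?_⟩
  have h0 : jTheta x s 0 = 0 := by
    have := jTheta_neg hx0 hx1 hs 0
    rwa [neg_zero, self_eq_neg] at this
  simpa [h0] using jTheta_add_eq_zero_iff hx0 hx1 hs 0 h

/-- The factor `[v + 1] [v + r - 1] / ([v] [v + r])`. -/
noncomputable def thetaRatio (x : ℝ) (s r v : ℂ) : ℂ :=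
  (jTheta x s (v + 1) * jTheta x s (v + (r - 1))) / (jTheta x s v * jTheta x s (v + r))

include hx0 hx1 in
lemma thetaRatio_add_period_right (r v : ℂ) :
    thetaRatio x s r (v + Real.pi * I / Real.log x) = thetaRatio x s r v := by
  simp only [thetaRatio, add_right_comm v _ (_ : ℂ), jTheta_add_period_right hx0 hx1]
  set P : ℂ := Real.pi * I / Real.log x
  have h : xpow x ((2 * (v + 1) * P + P ^ 2) / s) * xpow x ((2 * (v + (r - 1)) * P + P ^ 2) / s) =
      xpow x ((2 * v * P + P ^ 2) / s) * xpow x ((2 * (v + r) * P + P ^ 2) / s) := by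
    rw [← xpow_add, ← xpow_add]
    ring_nf
  have h0 := mul_ne_zero (xpow_ne_zero x ((2 * v * P + P ^ 2) / s))
    (xpow_ne_zero x ((2 * (v + r) * P + P ^ 2) / s))
  rw [← mul_div_mul_left _ (jTheta x s v * jTheta x s (v + r)) h0]
  congr 1
  · rw [← h]
    ring
  · ring

lemma isExchangeKernel_thetaRatio {r : ℂ} (hr : r ∉ (jThetaPeriodPair hx0 hx1 hs).lattice) :
    IsExchangeKernel (jThetaPeriodPair hx0 hx1 hs) r (thetaRatio x s r) where
  periodic v w hw := by
    induction hw using Submodule.span_induction generalizing v with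
    | mem w hw =>
      obtain h | h := hw
      · have h : w = s := h
        simp only [h, thetaRatio, add_right_comm v s, jTheta_add_period_left hx0 hx1 hs,
          neg_mul_neg]
      · have h : w = Real.pi * I / Real.log x := h
        rw [h]
        exact thetaRatio_add_period_right hx0 hx1 r v
    | zero => simp
    | add v w _ _ hv hw => rw [← add_assoc, hw, hv]
    | smul n w _ hw =>
      have h : Function.Periodic (thetaRatio x s r) w := hw
      exact h.zsmul n v
  reflect v := by
    have h1 : -v - r + 1 = -(v + (r - 1)) := by ring
    have h2 : -v - r + (r - 1) = -(v + 1) := by ring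
    have h3 : -v - r = -(v + r) := by ring
    have h4 : -v - r + r = -v := by ring
    rw [thetaRatio, thetaRatio, h1, h2, h4, h3]
    simp only [jTheta_neg hx0 hx1 hs, neg_mul_neg]
    rw [mul_comm (jTheta x s (v + (r - 1))), mul_comm (jTheta x s (v + r))]
  differentiableAt v h1 h2 := by
    have hd := differentiable_jTheta hx0 hx1 hs
    rw [← jTheta_eq_zero_iff] at h1 h2
    unfold thetaRatio
    exact DifferentiableAt.fun_div (by fun_prop) (by fun_prop) (mul_ne_zero h1 h2)
  residue := by
    have hd := differentiable_jTheta hx0 hx1 hs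
    have h0 : jTheta x s 0 = 0 := (jTheta_eq_zero_iff hx0 hx1 hs 0).mpr (zero_mem _)
    rw [← jTheta_eq_zero_iff] at hr
    have hslope := (hasDerivAt_iff_tendsto_slope_zero.mp (hd 0).hasDerivAt).inv₀
      (deriv_jTheta_zero_ne_zero hx0 hx1 hs)
    have hg : ContinuousAt (fun v => (jTheta x s (v + 1) * jTheta x s (v + (r - 1))) /
        jTheta x s (v + r)) 0 := by
      have hc := hd.continuous
      exact ContinuousAt.div₀ (by fun_prop) (by fun_prop) (by simpa using hr)
    refine ⟨_, (hslope.mul (hg.tendsto.mono_left nhdsWithin_le_nhds)).congr fun v => ?_⟩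
    simp only [zero_add, h0, sub_zero, smul_eq_mul, mul_inv, inv_inv, thetaRatio]
    rw [div_eq_mul_inv, div_eq_mul_inv, mul_inv]
    ring

end jTheta

section CutSum

open Finset

lemma cutSum_ite_univ (f : ℂ → ℂ) {ι : Type*} [Fintype ι] [DecidableEq ι] (n : ℕ) (u : ι → ℂ) :
    cutSum f (fun a => if a = n then 1 else 0) univ u =
      ∑ J ∈ powersetCard n univ, ∏ j ∈ J, ∏ k ∈ Jᶜ, f (u k - u j) := by
  simp only [cutSum, ite_mul, one_mul, zero_mul, ← sum_filter, cutProd, ← compl_eq_univ_sdiff,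
    powersetCard_eq_filter]

lemma sum_powersetCard_compl {ι : Type*} [Fintype ι] [DecidableEq ι] {n m : ℕ}
    (h : Fintype.card ι = n + m) (f : ℂ → ℂ) (u : ι → ℂ) :
    ∑ J ∈ powersetCard m univ, ∏ j ∈ J, ∏ k ∈ Jᶜ, f (u k - u j) =
      ∑ J ∈ powersetCard n univ, ∏ j ∈ J, ∏ k ∈ Jᶜ, f (-(u k - u j)) := by
  refine sum_nbij' compl compl ?_ ?_ (fun J _ => compl_compl J) (fun J _ => compl_compl J) ?_
  · intro J hJ
    simp only [mem_powersetCard_univ, card_compl] at hJ ⊢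
    omega
  · intro J hJ
    simp only [mem_powersetCard_univ, card_compl] at hJ ⊢
    omega
  · intro J _
    rw [compl_compl, Finset.prod_comm]
    simp only [neg_sub]

end CutSum

section Perturbation

open Finset

variable {x : ℝ} (hx0 : 0 < x) (hx1 : x < 1) {s : ℂ} (hs : 0 < s.re)
include hx0 hx1 hs

lemma eventually_sum_thetaRatio_eq (r : ℂ) (n m : ℕ) (u : Fin (n + m) → ℂ) :
    ∀ᶠ t in 𝓝[≠] (0 : ℂ),
      ∑ J ∈ powersetCard n univ, ∏ j ∈ J, ∏ k ∈ Jᶜ,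
        thetaRatio x s (r + t) (u k - u j + t * (3 * (k - j : ℤ))) =
      ∑ J ∈ powersetCard m univ, ∏ j ∈ J, ∏ k ∈ Jᶜ,
        thetaRatio x s (r + t) (u k - u j + t * (3 * (k - j : ℤ))) := by
  set L := jThetaPeriodPair hx0 hx1 hs
  have hgen : ∀ᶠ t in 𝓝[≠] (0 : ℂ), ∀ j k, j ≠ k →
      IsGeneric L (r + t) (u k - u j + t * (3 * (k - j : ℤ))) := by
    refine eventually_all.mpr fun j => eventually_all.mpr fun k => ?_
    by_cases hjk : j = k
    · exact .of_forall fun _ h => absurd hjk h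
    have : ∀ᶠ t in 𝓝[≠] (0 : ℂ), IsGeneric L (r + t) (u k - u j + t * (3 * (k - j : ℤ))) := by
      refine (eventually_all_finset _).mpr fun c hc => ?_
      rw [mem_Icc] at hc
      have hb : ((3 * (k - j : ℤ) + c : ℤ) : ℂ) ≠ 0 := by
        have : (j : ℕ) ≠ k := fun h => hjk (Fin.ext h)
        exact Int.cast_ne_zero.mpr (by omega)
      filter_upwards [L.eventually_notMem_lattice (u k - u j + c * r) hb 0] with t ht
      convert ht using 2
      push_cast
      ring
    filter_upwards [this] with t ht _ using ht
  filter_upwards [hgen, L.eventually_notMem_lattice r one_ne_zero 0,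
    L.eventually_notMem_lattice (r + r) two_ne_zero 0] with t ht hr hr2
  rw [mul_one] at hr
  have hr2' : r + t + (r + t) ∉ L.lattice := by
    convert hr2 using 2
    ring
  have hu : ∀ j k : Fin (n + m), u k + t * (3 * k) - (u j + t * (3 * j)) =
      u k - u j + t * (3 * (k - j : ℤ)) := fun j k => by
    push_cast
    ring
  have h := (isExchangeKernel_thetaRatio hx0 hx1 hs hr).cutSum_eq_cutSum_neg hr hr2' univ
    (fun a => if a = n then 1 else 0) (fun k : Fin (n + m) => u k + t * (3 * k))
    (fun j _ k _ hjk => by rw [hu]; exact ht j k hjk)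
  rw [cutSum_ite_univ, cutSum_ite_univ (fun v => thetaRatio x s (r + t) (-v)),
    ← sum_powersetCard_compl (m := m) (by simp)] at h
  simpa only [hu] using h

lemma tendsto_sum_thetaRatio {r : ℂ} {N : ℕ} (p : ℕ) {u : Fin N → ℂ}
    (h1 : ∀ j k, j ≠ k → jTheta x s (u k - u j) ≠ 0)
    (h2 : ∀ j k, j ≠ k → jTheta x s (u k - u j + r) ≠ 0) :
    Tendsto (fun t : ℂ => ∑ J ∈ powersetCard p univ, ∏ j ∈ J, ∏ k ∈ Jᶜ,
      thetaRatio x s (r + t) (u k - u j + t * (3 * (k - j : ℤ)))) (𝓝[≠] 0)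
      (𝓝 (∑ J ∈ powersetCard p univ, ∏ j ∈ J, ∏ k ∈ Jᶜ, thetaRatio x s r (u k - u j))) := by
  refine tendsto_finsetSum _ fun J _ => tendsto_finsetProd _ fun j hj =>
    tendsto_finsetProd _ fun k hk => ?_
  have hjk : j ≠ k := fun h => mem_compl.mp hk (h ▸ hj)
  have hc := (differentiable_jTheta hx0 hx1 hs).continuous
  have h : ContinuousAt (fun t : ℂ =>
      thetaRatio x s (r + t) (u k - u j + t * (3 * (k - j : ℤ)))) 0 := by
    unfold thetaRatio
    exact ContinuousAt.div₀ (by fun_prop) (by fun_prop)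
      (by simpa using ⟨h1 j k hjk, h2 j k hjk⟩)
  simpa [ContinuousAt] using h.tendsto.mono_left nhdsWithin_le_nhds

end Perturbation

open Finset in
theorem stmt12 (x : ℝ) (hx0 : 0 < x) (hx1 : x < 1) (s : ℂ) (hs : 0 < s.re) (r : ℂ)
    (n m : ℕ) (hn : 1 ≤ n) (hm : 1 ≤ m) (u : Fin (n + m) → ℂ)
    (h1 : ∀ j k : Fin (n + m), j ≠ k → jTheta x s (u k - u j) ≠ 0)
    (h2 : ∀ j k : Fin (n + m), j ≠ k → jTheta x s (u k - u j + r) ≠ 0) :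
    ∑ J ∈ powersetCard n (univ : Finset (Fin (n + m))), ∏ j ∈ J, ∏ k ∈ Jᶜ,
        (jTheta x s (u k - u j + 1) * jTheta x s (u k - u j + (r - 1))) /
          (jTheta x s (u k - u j) * jTheta x s (u k - u j + r)) =
    ∑ J ∈ powersetCard m (univ : Finset (Fin (n + m))), ∏ j ∈ J, ∏ k ∈ Jᶜ,
        (jTheta x s (u k - u j + 1) * jTheta x s (u k - u j + (r - 1))) /
          (jTheta x s (u k - u j) * jTheta x s (u k - u j + r)) := by
  have h := (tendsto_sum_thetaRatio hx0 hx1 hs m h1 h2).congr'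
    ((eventually_sum_thetaRatio_eq hx0 hx1 hs r n m u).mono fun _ ht => ht.symm)
  exact tendsto_nhds_unique (tendsto_sum_thetaRatio hx0 hx1 hs n h1 h2) h
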